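/- (L² norm error estimate, Theorem 4.1.) Let g ≥ 0, ε > 0, f(u) := u³ − g u² − ε u, and let u⁰, …, u^N ∈ V_h, U⁰, …, U^N ∈ V_h, ξ¹, …, ξ^N ∈ V_h, η¹, …, η^N ∈ V_h satisfy: u^n solves the variable-step L1 scheme D_τ^α u^n + (1+Δ_h)² u^n + f(u^n) = 0; the errors e^n := U^n − u^n satisfy e⁰ = 0 and D_τ^α e^n + (1+Δ_h)² e^n + f(U^n) − f(u^n) = ξ^n + η^n for 1 ≤ n ≤ N; ‖U^n‖_∞ ≤ c₁ and ‖u^n‖_∞ ≤ c₀ for all n. Set ρ := c₁² + c₁c₀ + c₀² + g(c₀ + c₁) + ε. If the maximum step size satisfies τ^α ≤ 1/(2Γ(2−α)ρ), then for every 1 ≤ n ≤ N, ‖e^n‖ ≤ 2 E_α(2ρ t_n^α / r*) ( max_{1≤k≤n} Σ_{j=1}^{k} p^{(k)}_{k−j} ‖ξ^j‖ + ω_{1+α}(t_n) max_{1≤j≤n} ‖η^j‖ ), where r* := min_{2≤k≤N} min{1, τ_k/τ_{k−1}} and E_α(z) := Σ_{k=0}^{∞} z^k/Γ(1+kα). 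-/

import Mathlib

open scoped BigOperators

/-- ω_β(t) = t^{β-1}/Γ(β) -/
noncomputable def omegaK (β t : ℝ) : ℝ := t ^ (β - 1) / Real.Gamma β

/-- variable-step L1 kernel: `aK α t n k = a^{(n)}_{n-k}` for `1 ≤ k ≤ n`. -/
noncomputable def aK (α : ℝ) (t : ℕ → ℝ) (n k : ℕ) : ℝ :=
  (1 / (t k - t (k - 1))) * ∫ s in (t (k - 1))..(t k), omegaK (1 - α) (t n - s)

/-- DCC kernel: `pK α t n m = p^{(n)}_m`, i.e. `p^{(n)}_{n-k} = pK α t n (n-k)`;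
`p^{(n)}_0 = 1/a^{(n)}_0` and
`p^{(n)}_{n-k} = (1/a^{(k)}_0) Σ_{j=k+1}^n (a^{(j)}_{j-k-1} - a^{(j)}_{j-k}) p^{(n)}_{n-j}`. -/
noncomputable def pK (α : ℝ) (t : ℕ → ℝ) (n : ℕ) : ℕ → ℝ
  | 0 => 1 / aK α t n n
  | m + 1 =>
      (1 / aK α t (n - m - 1) (n - m - 1)) *
        ∑ i ∈ (Finset.range (m + 1)).attach,
          (aK α t (n - i.1) (n - m) - aK α t (n - i.1) (n - m - 1)) * pK α t n i.1
  decreasing_by exact Finset.mem_range.mp i.2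

/-- discrete Laplacian on `L`-periodic grid functions (indices mod `M`) -/
noncomputable def dLap (M : ℕ) (h : ℝ) (v : ZMod M → ZMod M → ℝ) : ZMod M → ZMod M → ℝ :=
  fun i j => (v (i + 1) j + v (i - 1) j + v i (j + 1) + v i (j - 1) - 4 * v i j) / h ^ 2

/-- discrete inner product ⟨v,w⟩ = h² Σ_{ij} v_{ij} w_{ij} -/
noncomputable def dInner (M : ℕ) [NeZero M] (h : ℝ) (v w : ZMod M → ZMod M → ℝ) : ℝ :=
  h ^ 2 * ∑ i : ZMod M, ∑ j : ZMod M, v i j * w i j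

/-- discrete L² norm -/
noncomputable def dNorm (M : ℕ) [NeZero M] (h : ℝ) (v : ZMod M → ZMod M → ℝ) : ℝ :=
  Real.sqrt (dInner M h v v)

/-- the operator (1+Δ_h) -/
noncomputable def opA (M : ℕ) (h : ℝ) (v : ZMod M → ZMod M → ℝ) : ZMod M → ZMod M → ℝ :=
  v + dLap M h v

/-- pointwise nonlinearity f(u) = u³ - g u² - ε u -/
noncomputable def fPt (g ε : ℝ) (M : ℕ) (v : ZMod M → ZMod M → ℝ) : ZMod M → ZMod M → ℝ :=
  fun i j => (v i j) ^ 3 - g * (v i j) ^ 2 - ε * v i j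

/-- discrete energy E[v] = ½‖(1+Δ_h)v‖² + ¼‖v‖₄⁴ - (g/3)⟨v²,v⟩ - (ε/2)‖v‖² -/
noncomputable def dEnergy (M : ℕ) [NeZero M] (h g ε : ℝ) (v : ZMod M → ZMod M → ℝ) : ℝ :=
  (1 / 2) * dInner M h (opA M h v) (opA M h v)
    + (1 / 4) * (h ^ 2 * ∑ i : ZMod M, ∑ j : ZMod M, |v i j| ^ 4)
    - (g / 3) * dInner M h (fun i j => (v i j) ^ 2) v
    - (ε / 2) * dInner M h v v

/-- Mittag-Leffler function E_α(z) = Σ_{k≥0} z^k/Γ(1+kα) -/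
noncomputable def mittagLeffler (α z : ℝ) : ℝ := ∑' k : ℕ, z ^ k / Real.Gamma (1 + k * α)

/-- minimum step ratio r* = min_{2≤k≤N} min{1, τ_k/τ_{k-1}} -/
noncomputable def minStepRatio (t : ℕ → ℝ) (N : ℕ) : ℝ :=
  sInf (insert 1 ((fun k : ℕ => (t k - t (k - 1)) / (t (k - 1) - t (k - 2))) '' Set.Icc 2 N))

lemma omegaK_integrable (β a b : ℝ) (hβ : 0 < β) :
    IntervalIntegrable (fun s => omegaK β s) MeasureTheory.volume a b := by
  unfold omegaK
  exact (intervalIntegral.intervalIntegrable_rpow' (by linarith)).div_const _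

lemma omegaK_integral (β a b : ℝ) (hβ : 0 < β) :
    ∫ s in a..b, omegaK β s = omegaK (1 + β) b - omegaK (1 + β) a := by
  unfold omegaK
  rw [intervalIntegral.integral_div, integral_rpow (Or.inl (by linarith)),
    add_comm 1 β, Real.Gamma_add_one hβ.ne']
  have := (Real.Gamma_pos_of_pos hβ).ne'
  have h1 : β - 1 + 1 = β := by ring
  have h2 : β + 1 - 1 = β := by ring
  rw [h1, h2]
  field_simp

lemma omegaK_refl_integrable (β a b c : ℝ) (hβ : 0 < β) :
    IntervalIntegrable (fun s => omegaK β (c - s)) MeasureTheory.volume a b := by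
  have := (omegaK_integrable β (c - a) (c - b) hβ).comp_sub_left c
  simpa using this

lemma omegaK_refl_integral (β a b c : ℝ) (hβ : 0 < β) :
    ∫ s in a..b, omegaK β (c - s) = omegaK (1 + β) (c - a) - omegaK (1 + β) (c - b) := by
  rw [intervalIntegral.integral_comp_sub_left (fun s => omegaK β s) c, omegaK_integral _ _ _ hβ]

lemma omegaK_nonneg {β x : ℝ} (hβ : 0 < β) (hx : 0 ≤ x) : 0 ≤ omegaK β x :=
  div_nonneg (Real.rpow_nonneg hx _) (Real.Gamma_pos_of_pos hβ).le

lemma omegaK_pos {β x : ℝ} (hβ : 0 < β) (hx : 0 < x) : 0 < omegaK β x :=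
  div_pos (Real.rpow_pos_of_pos hx _) (Real.Gamma_pos_of_pos hβ)

lemma omegaK_anti {β x y : ℝ} (hβ : 0 < β) (hβ1 : β ≤ 1) (hx : 0 < x) (hxy : x ≤ y) :
    omegaK β y ≤ omegaK β x := by
  unfold omegaK
  exact div_le_div_of_nonneg_right
    (Real.rpow_le_rpow_of_nonpos hx hxy (by linarith)) (Real.Gamma_pos_of_pos hβ).le

lemma omegaK_mono {β x y : ℝ} (hβ1 : 1 ≤ β) (hx : 0 ≤ x) (hxy : x ≤ y) :
    omegaK β x ≤ omegaK β y := by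
  unfold omegaK
  exact div_le_div_of_nonneg_right
    (Real.rpow_le_rpow hx hxy (by linarith)) (Real.Gamma_pos_of_pos (by linarith)).le

/-- mean value theorem for the kernel average -/
lemma omegaK_mean (β a b c : ℝ) (hβ : 0 < β) (hab : a < b) (hbc : b ≤ c) :
    ∃ x ∈ Set.Ioo a b, (1 / (b - a)) * ∫ s in a..b, omegaK β (c - s) = omegaK β (c - x) := by
  have hG := (Real.Gamma_pos_of_pos hβ).ne'
  obtain ⟨x, hx, h⟩ := exists_hasDerivAt_eq_slope (fun s => - omegaK (1 + β) (c - s))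
    (fun s => omegaK β (c - s)) hab (by
      unfold omegaK
      apply ContinuousOn.neg
      apply ContinuousOn.div_const
      apply ContinuousOn.rpow_const
      · fun_prop
      · intro x hx
        right; linarith) (by
      intro x hx
      unfold omegaK
      have h1 : HasDerivAt (fun s => c - s) (-1) x := by
        simpa using (hasDerivAt_id x).const_sub c
      have h2 := (h1.rpow_const (p := 1 + β - 1) (Or.inl (by linarith [hx.2]))).div_const
        (Real.Gamma (1 + β))
      have e : (c - x) ^ (β - 1) / Real.Gamma β =
          -(-1 * (1 + β - 1) * (c - x) ^ (1 + β - 1 - 1) / Real.Gamma (1 + β)) := by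
        rw [add_comm 1 β, Real.Gamma_add_one hβ.ne']
        have h2 : β + 1 - 1 = β := by ring
        rw [h2]
        field_simp
      rw [e]
      exact h2.neg)
  refine ⟨x, hx, ?_⟩
  rw [h, omegaK_refl_integral _ _ _ _ hβ]
  ring

lemma omegaK_conv (γ β c : ℝ) (hγ : 0 < γ) (hβ : 0 < β) (hc : 0 < c) :
    ∫ s in (0:ℝ)..c, omegaK γ (c - s) * omegaK β s = omegaK (γ + β) c := by
  have h := Complex.betaIntegral_scaled (β : ℂ) (γ : ℂ) hc
  have h2 := Complex.betaIntegral_eq_Gamma_mul_div (β : ℂ) (γ : ℂ) (by simpa) (by simpa)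
  rw [h2] at h
  have h3 : ∫ x in (0:ℝ)..c, (x : ℂ) ^ ((β:ℂ) - 1) * ((c : ℂ) - x) ^ ((γ:ℂ) - 1)
      = ((∫ x in (0:ℝ)..c, x ^ (β - 1) * (c - x) ^ (γ - 1) : ℝ) : ℂ) := by
    rw [← intervalIntegral.integral_ofReal]
    apply intervalIntegral.integral_congr
    intro x hx
    rw [Set.uIcc_of_le hc.le] at hx
    simp only
    push_cast
    rw [Complex.ofReal_cpow hx.1, Complex.ofReal_cpow (by linarith [hx.2])]
    push_cast
    rfl
  rw [h3] at h
  have h4 : ∫ x in (0:ℝ)..c, x ^ (β - 1) * (c - x) ^ (γ - 1)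
      = c ^ (β + γ - 1) * (Real.Gamma β * Real.Gamma γ / Real.Gamma (β + γ)) := by
    have e : (c : ℂ) ^ ((β:ℂ) + γ - 1) = ((c ^ (β + γ - 1) : ℝ) : ℂ) := by
      rw [Complex.ofReal_cpow hc.le]; push_cast; rfl
    rw [e, ← Complex.ofReal_add, Complex.Gamma_ofReal, Complex.Gamma_ofReal, Complex.Gamma_ofReal] at h
    exact_mod_cast h
  have hb := (Real.Gamma_pos_of_pos hβ).ne'
  have hg := (Real.Gamma_pos_of_pos hγ).ne'
  have : ∀ s, omegaK γ (c - s) * omegaK β s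
      = (1 / (Real.Gamma β * Real.Gamma γ)) * (s ^ (β - 1) * (c - s) ^ (γ - 1)) := by
    intro s; unfold omegaK; field_simp
  simp_rw [this]
  rw [intervalIntegral.integral_const_mul, h4, add_comm β γ]
  unfold omegaK
  field_simp

lemma omegaK_conv_integrable (γ β c : ℝ) (hγ : 0 < γ) (hβ : 0 < β) (hc : 0 < c) :
    IntervalIntegrable (fun s => omegaK γ (c - s) * omegaK β s) MeasureTheory.volume 0 c := by
  apply intervalIntegral.intervalIntegrable_of_integral_ne_zero
  rw [omegaK_conv γ β c hγ hβ hc]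
  exact (omegaK_pos (by linarith) hc).ne'

/-- Chebyshev type inequality -/
lemma omegaK_cheb (γ β a b c : ℝ) (hγ : 0 < γ) (hγ1 : γ ≤ 1) (hβ : 0 < β) (hβ1 : β ≤ 1)
    (ha : 0 ≤ a) (hab : a < b) (hbc : b ≤ c)  :
    ∫ s in a..b, omegaK γ (c - s) * omegaK β s ≤
      ((1 / (b - a)) * ∫ s in a..b, omegaK γ (c - s)) *
        (omegaK (1 + β) b - omegaK (1 + β) a) := by
  obtain ⟨x, hx, h⟩ := omegaK_mean γ a b c hγ hab hbc
  have hintg : IntervalIntegrable (fun s => omegaK γ (c - s) * omegaK β s)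
      MeasureTheory.volume a b := by
    apply (omegaK_conv_integrable γ β c hγ hβ (by linarith)).mono_set
    rw [Set.uIcc_of_le hab.le, Set.uIcc_of_le (by linarith)]
    exact Set.Icc_subset_Icc ha hbc
  have i1 := omegaK_refl_integrable γ a b c hγ
  have i2 := omegaK_integrable β a b hβ
  have key : ∫ s in a..b, omegaK γ (c - s) * omegaK β s ≤
      ∫ s in a..b, (omegaK γ (c - x) * omegaK β s +
        (omegaK β x * omegaK γ (c - s) - omegaK β x * omegaK γ (c - x))) := by
    apply intervalIntegral.integral_mono_on_of_le_Ioo hab.le hintg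
    · exact (i2.const_mul _).add ((i1.const_mul _).sub intervalIntegrable_const)
    · intro s hs
      have : (omegaK γ (c - s) - omegaK γ (c - x)) * (omegaK β s - omegaK β x) ≤ 0 := by
        rcases le_total s x with hsx | hsx
        · apply mul_nonpos_of_nonpos_of_nonneg
          · rw [sub_nonpos]
            exact omegaK_anti hγ hγ1 (by linarith [hx.2]) (by linarith)
          · rw [sub_nonneg]
            exact omegaK_anti hβ hβ1 (by linarith [hs.1]) hsx
        · apply mul_nonpos_of_nonneg_of_nonpos
          · rw [sub_nonneg]
            exact omegaK_anti hγ hγ1 (by linarith [hs.2]) (by linarith)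
          · rw [sub_nonpos]
            exact omegaK_anti hβ hβ1 (by linarith [hx.1]) hsx
      nlinarith
  rw [intervalIntegral.integral_add (i2.const_mul _)
    ((i1.const_mul _).sub intervalIntegrable_const),
    intervalIntegral.integral_sub (i1.const_mul _) intervalIntegrable_const,
    intervalIntegral.integral_const_mul, intervalIntegral.integral_const_mul,
    intervalIntegral.integral_const, omegaK_integral _ _ _ hβ, smul_eq_mul] at key
  have h' : ∫ s in a..b, omegaK γ (c - s) = (b - a) * omegaK γ (c - x) := by
    rw [← h]; field_simp [(sub_pos.2 hab).ne']
  rw [h]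
  rw [h'] at key
  linarith

lemma omegaK_cheb2 (γ β a b c : ℝ) (hγ : 0 < γ) (hβ1 : 1 ≤ β)
    (ha : 0 ≤ a) (hab : a < b) (hbc : b ≤ c)  :
    ∫ s in a..b, omegaK γ (c - s) * omegaK β s ≤
      (∫ s in a..b, omegaK γ (c - s)) * omegaK β b := by
  have hintg : IntervalIntegrable (fun s => omegaK γ (c - s) * omegaK β s)
      MeasureTheory.volume a b := by
    apply (omegaK_conv_integrable γ β c hγ (by linarith) (by linarith)).mono_set
    rw [Set.uIcc_of_le hab.le, Set.uIcc_of_le (by linarith)]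
    exact Set.Icc_subset_Icc ha hbc
  rw [← intervalIntegral.integral_mul_const]
  apply intervalIntegral.integral_mono_on_of_le_Ioo hab.le hintg
  · exact (omegaK_refl_integrable γ a b c hγ).mul_const _
  · intro s hs
    exact mul_le_mul_of_nonneg_left (omegaK_mono hβ1 (by linarith [hs.1]) hs.2.le)
      (omegaK_nonneg hγ (by linarith [hs.2]))

lemma omegaK_step (β a b : ℝ) (hβ1 : 1 ≤ β) (ha : 0 ≤ a) (hab : a < b) :
    (b - a) * omegaK β a ≤ omegaK (1 + β) b - omegaK (1 + β) a := by
  rw [← omegaK_integral β a b (by linarith)]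
  have : (b - a) * omegaK β a = ∫ s in a..b, omegaK β a := by simp
  rw [this]
  apply intervalIntegral.integral_mono_on_of_le_Ioo hab.le intervalIntegrable_const
    (omegaK_integrable β a b (by linarith))
  intro s hs
  exact omegaK_mono hβ1 ha hs.1.le

/-- lower bound of the Gamma function -/
lemma Gamma_lower (R x : ℝ) (hR : 0 < R) (hx : 1 ≤ x) :
    Real.exp (-(R + 1)) * R ^ (x - 1) ≤ Real.Gamma x := by
  rw [Real.Gamma_eq_integral (by linarith)]
  have hi := Real.GammaIntegral_convergent (s := x) (by linarith)
  calc Real.exp (-(R + 1)) * R ^ (x - 1)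
      = ∫ s in Set.Ioc R (R + 1), Real.exp (-(R + 1)) * R ^ (x - 1) := by
        simp
    _ ≤ ∫ s in Set.Ioc R (R + 1), Real.exp (-s) * s ^ (x - 1) := by
        apply MeasureTheory.setIntegral_mono_on
        · exact MeasureTheory.integrableOn_const (by simp)
        · exact hi.mono_set (fun s hs => lt_trans hR hs.1)
        · exact measurableSet_Ioc
        · intro s hs
          apply mul_le_mul
          · exact Real.exp_le_exp.2 (by linarith [hs.2])
          · exact Real.rpow_le_rpow hR.le hs.1.le (by linarith)
          · positivity
          · positivity
    _ ≤ ∫ s in Set.Ioi 0, Real.exp (-s) * s ^ (x - 1) := by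
        apply MeasureTheory.setIntegral_mono_set hi
        · filter_upwards [MeasureTheory.ae_restrict_mem measurableSet_Ioi] with s hs
          have : (0:ℝ) < s := hs
          simp only [Pi.zero_apply]
          positivity
        · exact Filter.Eventually.of_forall (fun s hs => lt_trans hR hs.1)

lemma ml_summable (α z : ℝ) (hα : 0 < α) (hz : 0 ≤ z) :
    Summable (fun k : ℕ => z ^ k / Real.Gamma (1 + k * α)) := by
  set R : ℝ := (2 * z + 1) ^ (1 / α) with hRdef
  have hR : 0 < R := Real.rpow_pos_of_pos (by linarith) _
  have hRα : R ^ α = 2 * z + 1 := by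
    rw [hRdef, ← Real.rpow_mul (by linarith)]
    field_simp
    simp
  have hs : Summable (fun k : ℕ => Real.exp (R + 1) * (1 / 2 : ℝ) ^ k) :=
    (summable_geometric_of_lt_one (by norm_num) (by norm_num)).mul_left _
  refine Summable.of_nonneg_of_le ?_ ?_ hs
  · intro k
    exact div_nonneg (pow_nonneg hz k) (Real.Gamma_pos_of_pos (by positivity)).le
  · intro k
    have h1 := Gamma_lower R (1 + k * α) hR (by have : 0 ≤ k * α := by positivity
                                                linarith)
    have e : R ^ (1 + k * α - 1) = (2 * z + 1) ^ k := by
      rw [← hRα, ← Real.rpow_natCast, ← Real.rpow_mul hR.le]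
      congr 1; ring
    rw [e] at h1
    have hzk : (0:ℝ) < (2 * z + 1) ^ k := by positivity
    calc z ^ k / Real.Gamma (1 + k * α) ≤ z ^ k / (Real.exp (-(R + 1)) * (2 * z + 1) ^ k) := by
          apply div_le_div_of_nonneg_left (pow_nonneg hz k) (by positivity) h1
      _ = Real.exp (R + 1) * (z / (2 * z + 1)) ^ k := by
          rw [Real.exp_neg, div_pow]; field_simp
      _ ≤ _ := by
          have : z / (2 * z + 1) ≤ 1 / 2 := by
            rw [div_le_div_iff₀ (by linarith) (by norm_num)]
            linarith
          exact mul_le_mul_of_nonneg_left (pow_le_pow_left₀ (by positivity) this k) (by positivity)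

lemma mesh_lt {t : ℕ → ℝ} {N : ℕ} (htmono : ∀ k, k < N → t k < t (k + 1)) :
    ∀ i j, i < j → j ≤ N → t i < t j := by
  intro i j hij
  induction j, hij using Nat.le_induction with
  | base => intro h; exact htmono i h
  | succ j _ ih => intro h; exact lt_trans (ih (by omega)) (htmono j (by omega))

lemma mesh_le {t : ℕ → ℝ} {N : ℕ} (htmono : ∀ k, k < N → t k < t (k + 1)) :
    ∀ i j, i ≤ j → j ≤ N → t i ≤ t j := by
  intro i j hij hj
  rcases hij.eq_or_lt with rfl | h
  · exact le_rfl
  · exact (mesh_lt htmono i j h hj).le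

lemma aK_mean {α : ℝ} (hα : 0 < α ∧ α < 1) {t : ℕ → ℝ} {N : ℕ}
    (htmono : ∀ k, k < N → t k < t (k + 1)) {n k : ℕ} (hk : 1 ≤ k) (hkn : k ≤ n) (hn : n ≤ N) :
    ∃ x ∈ Set.Ioo (t (k - 1)) (t k), aK α t n k = omegaK (1 - α) (t n - x) :=
  omegaK_mean (1 - α) _ _ _ (by linarith) (mesh_lt htmono _ _ (by omega) (by omega))
    (mesh_le htmono _ _ hkn hn)

lemma aK_pos {α : ℝ} (hα : 0 < α ∧ α < 1) {t : ℕ → ℝ} {N : ℕ}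
    (htmono : ∀ k, k < N → t k < t (k + 1)) {n k : ℕ} (hk : 1 ≤ k) (hkn : k ≤ n) (hn : n ≤ N) :
    0 < aK α t n k := by
  obtain ⟨x, hx, h⟩ := aK_mean hα htmono hk hkn hn
  rw [h]
  have := mesh_le htmono _ _ hkn hn
  exact omegaK_pos (by linarith) (by linarith [hx.2])

lemma aK_mono {α : ℝ} (hα : 0 < α ∧ α < 1) {t : ℕ → ℝ} {N : ℕ}
    (htmono : ∀ k, k < N → t k < t (k + 1)) {n k : ℕ} (hk : 1 ≤ k) (hkn : k + 1 ≤ n) (hn : n ≤ N) :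
    aK α t n k ≤ aK α t n (k + 1) := by
  obtain ⟨x, hx, h⟩ := aK_mean hα htmono hk (by omega) hn
  obtain ⟨y, hy, h'⟩ := aK_mean hα htmono (k := k + 1) (by omega) hkn hn
  rw [h, h']
  have := mesh_le htmono _ _ hkn hn
  rw [Nat.add_sub_cancel] at hy
  exact omegaK_anti (by linarith) (by linarith) (by linarith [hy.2]) (by linarith [hx.2, hy.1])

lemma aK_diag {α : ℝ} (hα : 0 < α ∧ α < 1) {t : ℕ → ℝ} {N : ℕ}
    (htmono : ∀ k, k < N → t k < t (k + 1)) {n : ℕ} (hn1 : 1 ≤ n) (hn : n ≤ N) :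
    1 / aK α t n n = Real.Gamma (2 - α) * (t n - t (n - 1)) ^ α := by
  have hτ : 0 < t n - t (n - 1) := sub_pos.2 (mesh_lt htmono _ _ (by omega) hn)
  unfold aK
  rw [omegaK_refl_integral _ _ _ _ (by linarith)]
  unfold omegaK
  have e1 : (1 : ℝ) + (1 - α) - 1 = 1 - α := by ring
  have e2 : (1 : ℝ) + (1 - α) = 2 - α := by ring
  rw [e1, e2, sub_self, Real.zero_rpow (by linarith), Real.rpow_sub hτ, Real.rpow_one]
  have := (Real.Gamma_pos_of_pos (show 0 < 2 - α by linarith)).ne'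
  have := (Real.rpow_pos_of_pos hτ α).ne'
  have := hτ.ne'
  field_simp
  simp [this]

lemma pK_rec {α : ℝ} (hα : 0 < α ∧ α < 1) {t : ℕ → ℝ} {N : ℕ}
    (htmono : ∀ k, k < N → t k < t (k + 1)) {n k : ℕ} (hk : 1 ≤ k) (hkn : k < n) (hn : n ≤ N) :
    pK α t n (n - k) * aK α t k k =
      ∑ j ∈ Finset.Icc (k + 1) n, (aK α t j (k + 1) - aK α t j k) * pK α t n (n - j) := by
  obtain ⟨m, rfl⟩ : ∃ m, n = k + m + 1 := ⟨n - k - 1, by omega⟩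
  have e : k + m + 1 - k = m + 1 := by omega
  rw [e, pK]
  have e1 : k + m + 1 - m - 1 = k := by omega
  have e2 : k + m + 1 - m = k + 1 := by omega
  rw [e1, e2, Finset.sum_attach (Finset.range (m + 1)) (fun i =>
    (aK α t (k + m + 1 - i) (k + 1) - aK α t (k + m + 1 - i) k) * pK α t (k + m + 1) i)]
  have hpos := aK_pos hα htmono hk le_rfl (show k ≤ N by omega)
  rw [mul_right_comm, one_div_mul_cancel hpos.ne', one_mul]
  refine Finset.sum_bij' (fun i _ => k + m + 1 - i) (fun j _ => k + m + 1 - j) ?_ ?_ ?_ ?_ ?_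
  · intro i hi; simp at hi ⊢; omega
  · intro i hi; simp at hi ⊢; omega
  · intro i hi; simp at hi ⊢; omega
  · intro i hi; simp at hi ⊢; omega
  · intro i hi
    simp only [Finset.mem_range] at hi
    have : k + m + 1 - (k + m + 1 - i) = i := by omega
    rw [this]

lemma pK_nonneg {α : ℝ} (hα : 0 < α ∧ α < 1) {t : ℕ → ℝ} {N : ℕ}
    (htmono : ∀ k, k < N → t k < t (k + 1)) {n : ℕ} (hn : n ≤ N) :
    ∀ m k, 1 ≤ k → k + m = n → 0 ≤ pK α t n (n - k) := by
  intro m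
  induction m using Nat.strong_induction_on with
  | _ m ih =>
    intro k hk hkm
    rcases Nat.eq_zero_or_pos m with rfl | hm
    · have : n - k = 0 := by omega
      rw [this, pK]
      exact one_div_nonneg.2 (aK_pos hα htmono (by omega) le_rfl hn).le
    · have h := pK_rec hα htmono hk (show k < n by omega) hn
      have hpos := aK_pos hα htmono hk le_rfl (show k ≤ N by omega)
      refine nonneg_of_mul_nonneg_left ?_ hpos
      rw [h]
      apply Finset.sum_nonneg
      intro j hj
      rw [Finset.mem_Icc] at hj
      apply mul_nonneg
      · exact sub_nonneg.2 (aK_mono hα htmono hk hj.1 (by omega))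
      · exact ih (n - j) (by omega) j (by omega) (by omega)

lemma pK_compl {α : ℝ} (hα : 0 < α ∧ α < 1) {t : ℕ → ℝ} {N : ℕ}
    (htmono : ∀ k, k < N → t k < t (k + 1)) {n : ℕ} (hn : n ≤ N) :
    ∀ m k, 1 ≤ k → k + m = n →
      ∑ j ∈ Finset.Icc k n, pK α t n (n - j) * aK α t j k = 1 := by
  intro m
  induction m with
  | zero =>
    intro k hk hkm
    have : k = n := by omega
    subst this
    simp only [Finset.Icc_self, Finset.sum_singleton, Nat.sub_self]
    rw [pK, one_div_mul_cancel (aK_pos hα htmono hk le_rfl hn).ne']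
  | succ m ih =>
    intro k hk hkm
    rw [← Finset.insert_Icc_add_one_left_eq_Icc (show k ≤ n by omega),
      Finset.sum_insert (by simp), pK_rec hα htmono hk (by omega) hn, ← Finset.sum_add_distrib,
      ← ih (k + 1) (by omega) (by omega)]
    apply Finset.sum_congr rfl
    intro j _
    ring

/-- summation swap -/
lemma pK_swap (α : ℝ) (t : ℕ → ℝ) (n m : ℕ) (d : ℕ → ℝ) :
    ∑ j ∈ Finset.Icc 1 m, pK α t n (n - j) * ∑ k ∈ Finset.Icc 1 j, aK α t j k * d k
      = ∑ k ∈ Finset.Icc 1 m, (∑ j ∈ Finset.Icc k m, pK α t n (n - j) * aK α t j k) * d k := by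
  simp_rw [Finset.mul_sum, Finset.sum_mul]
  rw [Finset.sum_comm' (t' := Finset.Icc 1 m) (s' := fun k => Finset.Icc k m)]
  · simp_rw [mul_assoc]
  · intro x y; simp only [Finset.mem_Icc]; omega

lemma pK_swap_eq {α : ℝ} (hα : 0 < α ∧ α < 1) {t : ℕ → ℝ} {N : ℕ}
    (htmono : ∀ k, k < N → t k < t (k + 1)) {n : ℕ} (hn : n ≤ N) (d : ℕ → ℝ) :
    ∑ j ∈ Finset.Icc 1 n, pK α t n (n - j) * ∑ k ∈ Finset.Icc 1 j, aK α t j k * d k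
      = ∑ k ∈ Finset.Icc 1 n, d k := by
  rw [pK_swap]
  apply Finset.sum_congr rfl
  intro k hk
  rw [Finset.mem_Icc] at hk
  rw [pK_compl hα htmono hn (n - k) k hk.1 (by omega), one_mul]

lemma pK_swap_le {α : ℝ} (hα : 0 < α ∧ α < 1) {t : ℕ → ℝ} {N : ℕ}
    (htmono : ∀ k, k < N → t k < t (k + 1)) {n m : ℕ} (hn : n ≤ N) (hmn : m ≤ n) (d : ℕ → ℝ)
    (hd : ∀ k ∈ Finset.Icc 1 m, 0 ≤ d k) :
    ∑ j ∈ Finset.Icc 1 m, pK α t n (n - j) * ∑ k ∈ Finset.Icc 1 j, aK α t j k * d k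
      ≤ ∑ k ∈ Finset.Icc 1 m, d k := by
  rw [pK_swap]
  apply Finset.sum_le_sum
  intro k hk
  have hd' := hd k hk
  rw [Finset.mem_Icc] at hk
  apply mul_le_of_le_one_left hd'
  rw [← pK_compl hα htmono hn (n - k) k hk.1 (by omega)]
  apply Finset.sum_le_sum_of_subset_of_nonneg
  · exact Finset.Icc_subset_Icc le_rfl hmn
  · intro j hj _
    rw [Finset.mem_Icc] at hj
    exact mul_nonneg (pK_nonneg hα htmono hn (n - j) j (by omega) (by omega))
      (aK_pos hα htmono hk.1 hj.1 (by omega)).le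

lemma sum_telescope (v : ℕ → ℝ) (n : ℕ) :
    ∑ k ∈ Finset.Icc 1 n, (v k - v (k - 1)) = v n - v 0 := by
  induction n with
  | zero => simp
  | succ n ih => rw [Finset.sum_Icc_succ_top (by omega), ih]; simp

lemma sum_telescope' (v : ℕ → ℝ) (n : ℕ) :
    ∑ k ∈ Finset.Icc 1 n, (v (k + 1) - v k) = v (n + 1) - v 1 := by
  induction n with
  | zero => simp
  | succ n ih => rw [Finset.sum_Icc_succ_top (by omega), ih]; ring

lemma conv_split {α : ℝ} (hα : 0 < α ∧ α < 1) {t : ℕ → ℝ} {N : ℕ} (ht0 : t 0 = 0)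
    (htmono : ∀ k, k < N → t k < t (k + 1)) (β : ℝ) (hβ : 0 < β) {j : ℕ} (hj1 : 1 ≤ j)
    (hj : j ≤ N) :
    omegaK (1 - α + β) (t j) = ∑ k ∈ Finset.Icc 1 j,
      ∫ s in (t (k - 1))..(t k), omegaK (1 - α) (t j - s) * omegaK β s := by
  have hpos : 0 < t j := ht0 ▸ mesh_lt htmono 0 j (by omega) hj
  rw [← omegaK_conv (1 - α) β (t j) (by linarith) hβ hpos]
  have hs := intervalIntegral.sum_integral_adjacent_intervals (μ := MeasureTheory.volume)
    (f := fun s => omegaK (1 - α) (t j - s) * omegaK β s) (a := t) (n := j) (by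
      intro k hk
      apply (omegaK_conv_integrable (1 - α) β (t j) (by linarith) hβ hpos).mono_set
      rw [Set.uIcc_of_le (htmono k (by omega)).le, Set.uIcc_of_le hpos.le]
      apply Set.Icc_subset_Icc
      · rw [← ht0]; exact mesh_le htmono 0 k (by omega) (by omega)
      · exact mesh_le htmono _ _ (by omega) hj)
  rw [ht0] at hs
  rw [← hs]
  refine Finset.sum_bij' (fun i _ => i + 1) (fun i _ => i - 1) ?_ ?_ ?_ ?_ ?_
  · intro i hi; simp at hi ⊢; omega
  · intro i hi; simp at hi ⊢; omega
  · intro i hi; simp at hi ⊢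
  · intro i hi; simp at hi ⊢; omega
  · intro i hi; simp

lemma pK_sum_low {α : ℝ} (hα : 0 < α ∧ α < 1) {t : ℕ → ℝ} {N : ℕ} (ht0 : t 0 = 0)
    (htmono : ∀ k, k < N → t k < t (k + 1)) (β : ℝ) (hβ : 0 < β) (hβ1 : β ≤ 1) {n : ℕ}
    (hn : n ≤ N) :
    ∑ j ∈ Finset.Icc 1 n, pK α t n (n - j) * omegaK (1 - α + β) (t j) ≤ omegaK (1 + β) (t n) := by
  calc _ ≤ ∑ j ∈ Finset.Icc 1 n, pK α t n (n - j) * ∑ k ∈ Finset.Icc 1 j, aK α t j k *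
        (omegaK (1 + β) (t k) - omegaK (1 + β) (t (k - 1))) := by
        apply Finset.sum_le_sum
        intro j hj
        rw [Finset.mem_Icc] at hj
        apply mul_le_mul_of_nonneg_left _
          (pK_nonneg hα htmono hn (n - j) j (by omega) (by omega))
        rw [conv_split hα ht0 htmono β hβ hj.1 (by omega)]
        apply Finset.sum_le_sum
        intro k hk
        rw [Finset.mem_Icc] at hk
        exact omegaK_cheb (1 - α) β _ _ _ (by linarith) (by linarith) hβ hβ1
          (by rw [← ht0]; exact mesh_le htmono _ _ (by omega) (by omega))
          (mesh_lt htmono _ _ (by omega) (by omega)) (mesh_le htmono _ _ (by omega) (by omega))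
    _ = omegaK (1 + β) (t n) := by
        rw [pK_swap_eq hα htmono hn, sum_telescope (fun k => omegaK (1 + β) (t k)), ht0]
        have : omegaK (1 + β) 0 = 0 := by
          unfold omegaK
          rw [Real.zero_rpow (by linarith), zero_div]
        rw [this, sub_zero]

lemma pK_sum_high {α : ℝ} (hα : 0 < α ∧ α < 1) {t : ℕ → ℝ} {N : ℕ} (ht0 : t 0 = 0)
    (htmono : ∀ k, k < N → t k < t (k + 1)) (β : ℝ) (hβ1 : 1 ≤ β) {n : ℕ}
    (hn : n + 1 ≤ N) (r : ℝ) (hr : 0 < r)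
    (hrt : ∀ k, 1 ≤ k → k + 1 ≤ N → r * (t k - t (k - 1)) ≤ t (k + 1) - t k) :
    ∑ j ∈ Finset.Icc 1 n, pK α t (n + 1) (n + 1 - j) * omegaK (1 - α + β) (t j) ≤
      (1 / r) * omegaK (1 + β) (t (n + 1)) := by
  have tn : ∀ k, k ≤ N → 0 ≤ t k := fun k hk => by
    rw [← ht0]; exact mesh_le htmono _ _ (by omega) (by omega)
  calc _ ≤ ∑ j ∈ Finset.Icc 1 n, pK α t (n + 1) (n + 1 - j) * ∑ k ∈ Finset.Icc 1 j, aK α t j k *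
        ((1 / r) * (omegaK (1 + β) (t (k + 1)) - omegaK (1 + β) (t k))) := by
        apply Finset.sum_le_sum
        intro j hj
        rw [Finset.mem_Icc] at hj
        apply mul_le_mul_of_nonneg_left _
          (pK_nonneg hα htmono hn (n + 1 - j) j (by omega) (by omega))
        rw [conv_split hα ht0 htmono β (by linarith) hj.1 (by omega)]
        apply Finset.sum_le_sum
        intro k hk
        rw [Finset.mem_Icc] at hk
        have hlt := mesh_lt htmono (k - 1) k (by omega) (by omega)
        refine (omegaK_cheb2 (1 - α) β _ _ _ (by linarith) hβ1
          (tn _ (by omega)) hlt (mesh_le htmono _ _ (by omega) (by omega))).trans ?_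
        have e : ∫ s in (t (k - 1))..(t k), omegaK (1 - α) (t j - s)
            = aK α t j k * (t k - t (k - 1)) := by
          unfold aK
          have := (sub_pos.2 hlt).ne'
          field_simp
        rw [e, mul_assoc]
        apply mul_le_mul_of_nonneg_left _ (aK_pos hα htmono hk.1 hk.2 (by omega)).le
        have h1 := omegaK_step β (t k) (t (k + 1)) hβ1 (tn _ (by omega)) (htmono k (by omega))
        have h2 := hrt k hk.1 (by omega)
        have h3 := omegaK_nonneg (β := β) (by linarith) (tn k (by omega))
        rw [one_div, ← div_eq_inv_mul, le_div_iff₀ hr]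
        nlinarith [mul_le_mul_of_nonneg_right h2 h3]
    _ ≤ ∑ k ∈ Finset.Icc 1 n,
        ((1 / r) * (omegaK (1 + β) (t (k + 1)) - omegaK (1 + β) (t k))) := by
        apply pK_swap_le hα htmono hn (by omega)
        intro k hk
        rw [Finset.mem_Icc] at hk
        apply mul_nonneg (by positivity)
        exact sub_nonneg.2 (omegaK_mono (by linarith) (tn _ (by omega)) (htmono k (by omega)).le)
    _ ≤ _ := by
        rw [← Finset.mul_sum, sum_telescope' (fun k => omegaK (1 + β) (t k))]
        apply mul_le_mul_of_nonneg_left _ (by positivity)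
        have := omegaK_nonneg (β := 1 + β) (by linarith) (tn 1 (by omega))
        linarith

lemma pK_sum_all {α : ℝ} (hα : 0 < α ∧ α < 1) {t : ℕ → ℝ} {N : ℕ} (ht0 : t 0 = 0)
    (htmono : ∀ k, k < N → t k < t (k + 1)) {n : ℕ}
    (hn : n + 1 ≤ N) (r : ℝ) (hr : 0 < r) (hr1 : r ≤ 1)
    (hrt : ∀ k, 1 ≤ k → k + 1 ≤ N → r * (t k - t (k - 1)) ≤ t (k + 1) - t k) (k : ℕ) :
    ∑ j ∈ Finset.Icc 1 n, pK α t (n + 1) (n + 1 - j) * omegaK (1 + k * α) (t j) ≤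
      (1 / r) * omegaK (1 + (k + 1 : ℕ) * α) (t (n + 1)) := by
  have tn : ∀ k, k ≤ N → 0 ≤ t k := fun k hk => by
    rw [← ht0]; exact mesh_le htmono _ _ (by omega) (by omega)
  have e : (1 : ℝ) + k * α = 1 - α + (k + 1 : ℕ) * α := by push_cast; ring
  have hβ : 0 < ((k + 1 : ℕ) : ℝ) * α := by have := hα.1; positivity
  have hα0 := hα.1
  rcases le_total (((k + 1 : ℕ) : ℝ) * α) 1 with h | h
  · have h1 := pK_sum_low hα ht0 htmono _ hβ h hn
    rw [← e, Finset.sum_Icc_succ_top (by omega)] at h1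
    have h2 : 0 ≤ pK α t (n + 1) (n + 1 - (n + 1)) * omegaK (1 + k * α) (t (n + 1)) :=
      mul_nonneg (pK_nonneg hα htmono hn 0 (n + 1) (by omega) (by omega))
        (omegaK_nonneg (by positivity) (tn _ hn))
    have h3 : omegaK (1 + (k + 1 : ℕ) * α) (t (n + 1)) ≤
        (1 / r) * omegaK (1 + (k + 1 : ℕ) * α) (t (n + 1)) := by
      apply le_mul_of_one_le_left (omegaK_nonneg (by positivity) (tn _ hn))
      rw [le_div_iff₀ hr]; linarith
    linarith
  · rw [e]
    exact pK_sum_high hα ht0 htmono _ h hn r hr hrt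

lemma ml_term (α κ x : ℝ) (hx : 0 ≤ x) (k : ℕ) :
    (κ * x ^ α) ^ k / Real.Gamma (1 + k * α) = κ ^ k * omegaK (1 + k * α) x := by
  unfold omegaK
  rw [mul_pow, ← Real.rpow_natCast (x ^ α) k, ← Real.rpow_mul hx, mul_div_assoc]
  congr 3
  ring

lemma ml_nonneg {α z : ℝ} (hα : 0 < α) (hz : 0 ≤ z) : 0 ≤ mittagLeffler α z :=
  tsum_nonneg fun k => div_nonneg (pow_nonneg hz k) (Real.Gamma_pos_of_pos (by positivity)).le

lemma ml_step {α : ℝ} (hα : 0 < α ∧ α < 1) {t : ℕ → ℝ} {N : ℕ} (ht0 : t 0 = 0)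
    (htmono : ∀ k, k < N → t k < t (k + 1)) {n : ℕ}
    (hn : n + 1 ≤ N) (r : ℝ) (hr : 0 < r) (hr1 : r ≤ 1)
    (hrt : ∀ k, 1 ≤ k → k + 1 ≤ N → r * (t k - t (k - 1)) ≤ t (k + 1) - t k)
    (κ : ℝ) (hκ : 0 ≤ κ) :
    1 + κ * r * ∑ j ∈ Finset.Icc 1 n, pK α t (n + 1) (n + 1 - j) *
      mittagLeffler α (κ * t j ^ α) ≤ mittagLeffler α (κ * t (n + 1) ^ α) := by
  have tn : ∀ k, k ≤ N → 0 ≤ t k := fun k hk => by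
    rw [← ht0]; exact mesh_le htmono _ _ (by omega) (by omega)
  have hsum : ∀ j, j ≤ N → Summable (fun k : ℕ => κ ^ k * omegaK (1 + k * α) (t j)) := by
    intro j hj
    have := ml_summable α (κ * t j ^ α) hα.1 (mul_nonneg hκ (Real.rpow_nonneg (tn j hj) _))
    simpa only [ml_term α κ (t j) (tn j hj)] using this
  have hE : ∀ j, j ≤ N → mittagLeffler α (κ * t j ^ α) =
      ∑' k : ℕ, κ ^ k * omegaK (1 + k * α) (t j) := by
    intro j hj
    unfold mittagLeffler
    simp only [ml_term α κ (t j) (tn j hj)]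
  have h1 : κ * r * ∑ j ∈ Finset.Icc 1 n, pK α t (n + 1) (n + 1 - j) *
      mittagLeffler α (κ * t j ^ α) = ∑' k : ℕ, κ * r * (∑ j ∈ Finset.Icc 1 n,
        pK α t (n + 1) (n + 1 - j) * (κ ^ k * omegaK (1 + k * α) (t j))) := by
    rw [tsum_mul_left, Summable.tsum_finsetSum]
    · congr 1
      apply Finset.sum_congr rfl
      intro j hj
      rw [Finset.mem_Icc] at hj
      rw [tsum_mul_left, hE j (by omega)]
    · intro j hj
      rw [Finset.mem_Icc] at hj
      exact (hsum j (by omega)).mul_left _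
  have hs1 : Summable (fun k : ℕ => κ * r * (∑ j ∈ Finset.Icc 1 n,
        pK α t (n + 1) (n + 1 - j) * (κ ^ k * omegaK (1 + k * α) (t j)))) := by
    apply Summable.mul_left
    apply summable_sum
    intro j hj
    rw [Finset.mem_Icc] at hj
    exact (hsum j (by omega)).mul_left _
  rw [h1, hE _ hn, (hsum _ hn).tsum_eq_zero_add]
  have e0 : κ ^ 0 * omegaK (1 + ((0 : ℕ) : ℝ) * α) (t (n + 1)) = 1 := by
    unfold omegaK; simp
  rw [e0]
  have := Summable.tsum_le_tsum (f := fun k : ℕ => κ * r * (∑ j ∈ Finset.Icc 1 n,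
        pK α t (n + 1) (n + 1 - j) * (κ ^ k * omegaK (1 + k * α) (t j))))
    (g := fun k : ℕ => κ ^ (k + 1) * omegaK (1 + (k + 1 : ℕ) * α) (t (n + 1))) (by
      intro k
      have h := pK_sum_all hα ht0 htmono hn r hr hr1 hrt k
      have h' := mul_le_mul_of_nonneg_left h (show 0 ≤ κ ^ (k + 1) * r by positivity)
      calc _ = κ ^ (k + 1) * r * ∑ j ∈ Finset.Icc 1 n,
            pK α t (n + 1) (n + 1 - j) * omegaK (1 + k * α) (t j) := by
            rw [Finset.mul_sum, Finset.mul_sum]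
            apply Finset.sum_congr rfl
            intro j _
            ring
        _ ≤ _ := h'
        _ = _ := by field_simp) hs1 ((summable_nat_add_iff 1).2 (hsum _ hn))
  linarith

lemma gronwall_L1 {α : ℝ} (hα : 0 < α ∧ α < 1) {t : ℕ → ℝ} {N : ℕ} (ht0 : t 0 = 0)
    (htmono : ∀ k, k < N → t k < t (k + 1)) (r : ℝ) (hr : 0 < r) (hr1 : r ≤ 1)
    (hrt : ∀ k, 1 ≤ k → k + 1 ≤ N → r * (t k - t (k - 1)) ≤ t (k + 1) - t k)
    (ρ : ℝ) (hρ : 0 < ρ)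
    (hτ : ∀ k, 1 ≤ k → k ≤ N →
      (t k - t (k - 1)) ^ α ≤ 1 / (2 * Real.Gamma (2 - α) * ρ))
    (v x y : ℕ → ℝ) (hv0 : v 0 = 0) (hx : ∀ n, 0 ≤ x n) (hy : ∀ n, 0 ≤ y n)
    (hv : ∀ n, 0 ≤ v n)
    (h : ∀ n, 1 ≤ n → n ≤ N →
      ∑ k ∈ Finset.Icc 1 n, aK α t n k * (v k - v (k - 1)) ≤ ρ * v n + x n + y n) :
    ∀ n, ∀ hn1 : 1 ≤ n, n ≤ N →
      v n ≤ 2 * mittagLeffler α (2 * ρ * (t n) ^ α / r) *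
          ((Finset.Icc 1 n).sup' (Finset.nonempty_Icc.mpr hn1)
              (fun k => ∑ j ∈ Finset.Icc 1 k, pK α t k (k - j) * x j)
            + omegaK (1 + α) (t n) *
                (Finset.Icc 1 n).sup' (Finset.nonempty_Icc.mpr hn1) (fun j => y j)) := by
  have tn : ∀ k, k ≤ N → 0 ≤ t k := fun k hk => by
    rw [← ht0]; exact mesh_le htmono _ _ (by omega) (by omega)
  intro n
  induction n using Nat.strong_induction_on with
  | _ n ih =>
  intro hn1 hn
  set κ : ℝ := 2 * ρ / r with hκdef
  have hκ : 0 < κ := by positivity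
  have eκ : ∀ j, 2 * ρ * (t j) ^ α / r = κ * t j ^ α := fun j => by rw [hκdef]; ring
  obtain ⟨m, rfl⟩ : ∃ m, n = m + 1 := ⟨n - 1, by omega⟩
  have hpn : ∀ j, 1 ≤ j → j ≤ m + 1 → 0 ≤ pK α t (m + 1) (m + 1 - j) := fun j h1 h2 =>
    pK_nonneg hα htmono hn (m + 1 - j) j h1 (by omega)
  set X := (Finset.Icc 1 (m + 1)).sup' (Finset.nonempty_Icc.mpr hn1)
              (fun k => ∑ j ∈ Finset.Icc 1 k, pK α t k (k - j) * x j) with hX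
  set Y := (Finset.Icc 1 (m + 1)).sup' (Finset.nonempty_Icc.mpr hn1) (fun j => y j) with hY
  have hmem : m + 1 ∈ Finset.Icc 1 (m + 1) := by simp
  have hXn : ∑ j ∈ Finset.Icc 1 (m + 1), pK α t (m + 1) (m + 1 - j) * x j ≤ X :=
    Finset.le_sup' (fun k => ∑ j ∈ Finset.Icc 1 k, pK α t k (k - j) * x j) hmem
  have hX0 : 0 ≤ X := by
    refine le_trans (Finset.sum_nonneg ?_) hXn
    intro j hj
    rw [Finset.mem_Icc] at hj
    exact mul_nonneg (hpn j hj.1 hj.2) (hx j)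
  have hYj : ∀ j ∈ Finset.Icc 1 (m + 1), y j ≤ Y := fun j hj => Finset.le_sup' (fun j => y j) hj
  have hY0 : 0 ≤ Y := (hy _).trans (hYj _ hmem)
  have hω0 : ∀ j, j ≤ N → 0 ≤ omegaK (1 + α) (t j) := fun j hj =>
    omegaK_nonneg (by linarith) (tn j hj)
  set G := X + omegaK (1 + α) (t (m + 1)) * Y with hG
  have hG0 : 0 ≤ G := add_nonneg hX0 (mul_nonneg (hω0 _ hn) hY0)
  have hE0 : ∀ j, j ≤ N → 0 ≤ mittagLeffler α (κ * t j ^ α) := fun j hj =>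
    ml_nonneg hα.1 (mul_nonneg hκ.le (Real.rpow_nonneg (tn j hj) _))
  -- previous bounds
  have hprev : ∀ j ∈ Finset.Icc 1 m, v j ≤ 2 * mittagLeffler α (κ * t j ^ α) * G := by
    intro j hj
    rw [Finset.mem_Icc] at hj
    have := ih j (by omega) hj.1 (by omega)
    rw [eκ] at this
    refine this.trans (mul_le_mul_of_nonneg_left ?_
      (mul_nonneg (by norm_num) (hE0 j (by omega))))
    have hsub : Finset.Icc 1 j ⊆ Finset.Icc 1 (m + 1) := Finset.Icc_subset_Icc le_rfl (by omega)
    apply add_le_add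
    · exact Finset.sup'_mono _ hsub _
    · apply mul_le_mul
      · exact omegaK_mono (by linarith) (tn j (by omega)) (mesh_le htmono _ _ (by omega) hn)
      · exact Finset.sup'_mono _ hsub _
      · refine (hy 1).trans (Finset.le_sup' (fun j => y j) ?_)
        simp [hj.1]
      · exact hω0 _ hn
  -- summed inequality
  have hsum : v (m + 1) ≤ ∑ j ∈ Finset.Icc 1 (m + 1), pK α t (m + 1) (m + 1 - j) *
      (ρ * v j + x j + y j) := by
    have h1 := pK_swap_eq hα htmono hn (fun k => v k - v (k - 1))
    rw [sum_telescope v, hv0, sub_zero] at h1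
    rw [← h1]
    apply Finset.sum_le_sum
    intro j hj
    rw [Finset.mem_Icc] at hj
    exact mul_le_mul_of_nonneg_left (h j hj.1 (by omega)) (hpn j hj.1 hj.2)
  have hYsum : ∑ j ∈ Finset.Icc 1 (m + 1), pK α t (m + 1) (m + 1 - j) * y j ≤
      omegaK (1 + α) (t (m + 1)) * Y := by
    have h1 := pK_sum_low hα ht0 htmono α hα.1 hα.2.le hn
    have e1 : ∀ s, omegaK (1 - α + α) s = 1 := by
      intro s; unfold omegaK; simp
    simp only [e1, mul_one] at h1
    calc _ ≤ ∑ j ∈ Finset.Icc 1 (m + 1), pK α t (m + 1) (m + 1 - j) * Y := by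
          apply Finset.sum_le_sum
          intro j hj
          have := hYj j hj
          rw [Finset.mem_Icc] at hj
          exact mul_le_mul_of_nonneg_left this (hpn j hj.1 hj.2)
      _ ≤ _ := by
          rw [← Finset.sum_mul]
          exact mul_le_mul_of_nonneg_right h1 hY0
  have hsplit : v (m + 1) ≤ ρ * ∑ j ∈ Finset.Icc 1 (m + 1), pK α t (m + 1) (m + 1 - j) * v j
      + G := by
    have e1 : ∑ j ∈ Finset.Icc 1 (m + 1), pK α t (m + 1) (m + 1 - j) * (ρ * v j + x j + y j)
        = ρ * ∑ j ∈ Finset.Icc 1 (m + 1), pK α t (m + 1) (m + 1 - j) * v j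
        + ∑ j ∈ Finset.Icc 1 (m + 1), pK α t (m + 1) (m + 1 - j) * x j
        + ∑ j ∈ Finset.Icc 1 (m + 1), pK α t (m + 1) (m + 1 - j) * y j := by
      rw [Finset.mul_sum, ← Finset.sum_add_distrib, ← Finset.sum_add_distrib]
      apply Finset.sum_congr rfl
      intro j _
      ring
    linarith
  rw [Finset.sum_Icc_succ_top (by omega)] at hsplit
  have hp0 : ρ * pK α t (m + 1) (m + 1 - (m + 1)) ≤ 1 / 2 := by
    rw [Nat.sub_self, pK, aK_diag hα htmono hn1 hn]
    have hΓ := Real.Gamma_pos_of_pos (show 0 < 2 - α by linarith [hα.2])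
    have := hτ (m + 1) hn1 hn
    rw [le_div_iff₀ (by positivity)] at this
    linarith
  have hhalf : v (m + 1) ≤ 2 * ρ * ∑ j ∈ Finset.Icc 1 m, pK α t (m + 1) (m + 1 - j) * v j
      + 2 * G := by
    have := mul_le_mul_of_nonneg_right hp0 (hv (m + 1))
    nlinarith
  have hml := ml_step hα ht0 htmono hn r hr hr1 hrt κ hκ.le
  have eκr : κ * r = 2 * ρ := by rw [hκdef]; field_simp
  rw [eκr] at hml
  rw [eκ]
  have hS : ∑ j ∈ Finset.Icc 1 m, pK α t (m + 1) (m + 1 - j) * v j ≤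
      2 * G * ∑ j ∈ Finset.Icc 1 m, pK α t (m + 1) (m + 1 - j) *
        mittagLeffler α (κ * t j ^ α) := by
    rw [Finset.mul_sum]
    apply Finset.sum_le_sum
    intro j hj
    have h1 := hprev j hj
    rw [Finset.mem_Icc] at hj
    calc _ ≤ pK α t (m + 1) (m + 1 - j) * (2 * mittagLeffler α (κ * t j ^ α) * G) :=
          mul_le_mul_of_nonneg_left h1 (hpn j hj.1 (by omega))
      _ = _ := by ring
  have h5 := mul_le_mul_of_nonneg_left hS (show 0 ≤ 2 * ρ by positivity)
  have h6 := mul_le_mul_of_nonneg_left hml (show 0 ≤ 2 * G by positivity)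
  linarith

lemma abel_nonneg (a w : ℕ → ℝ) (n : ℕ) (hn : 1 ≤ n) (ha1 : 0 ≤ a 1)
    (ha : ∀ k, 1 ≤ k → k + 1 ≤ n → a k ≤ a (k + 1)) (hw : ∀ k, k ≤ n → w k ≤ 0) :
    a n * w n ≤ ∑ k ∈ Finset.Icc 1 n, a k * (w k - w (k - 1)) := by
  induction n, hn using Nat.le_induction with
  | base => simp; nlinarith [hw 0 (by omega)]
  | succ n hn ih =>
    rw [Finset.sum_Icc_succ_top (by omega)]
    have h1 := ih (fun k h1 h2 => ha k h1 (by omega)) (fun k hk => hw k (by omega))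
    have h2 := ha n hn le_rfl
    have h3 := hw n (by omega)
    simp only [Nat.add_sub_cancel]
    nlinarith

lemma minStepRatio_spec {t : ℕ → ℝ} {N : ℕ} (htmono : ∀ k, k < N → t k < t (k + 1)) :
    0 < minStepRatio t N ∧ minStepRatio t N ≤ 1 ∧
    ∀ k, 1 ≤ k → k + 1 ≤ N → minStepRatio t N * (t k - t (k - 1)) ≤ t (k + 1) - t k := by
  unfold minStepRatio
  set S : Set ℝ := insert 1
    ((fun k : ℕ => (t k - t (k - 1)) / (t (k - 1) - t (k - 2))) '' Set.Icc 2 N) with hS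
  have hfin : S.Finite := ((Set.finite_Icc 2 N).image _).insert 1
  have hne : S.Nonempty := ⟨1, by simp [hS]⟩
  refine ⟨?_, ?_, ?_⟩
  · have hmem := hne.csInf_mem hfin
    rcases hmem with h | ⟨k, hk, h⟩
    · rw [h]; norm_num
    · rw [← h]
      have hk1 := hk.1
      have hk2 := hk.2
      exact div_pos (sub_pos.2 (mesh_lt htmono _ _ (by omega) (by omega)))
        (sub_pos.2 (mesh_lt htmono _ _ (by omega) (by omega)))
  · exact csInf_le hfin.bddBelow (by simp [hS])
  · intro k hk hkN
    rw [← le_div_iff₀ (sub_pos.2 (mesh_lt htmono _ _ (by omega) (by omega)))]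
    apply csInf_le hfin.bddBelow
    right
    exact ⟨k + 1, ⟨by omega, hkN⟩, by simp⟩

section grid

variable {M : ℕ} [NeZero M]

lemma dInner_add_left (h : ℝ) (v w z : ZMod M → ZMod M → ℝ) :
    dInner M h (v + w) z = dInner M h v z + dInner M h w z := by
  simp only [dInner, Pi.add_apply, add_mul, Finset.sum_add_distrib, mul_add]

lemma dInner_sub_left (h : ℝ) (v w z : ZMod M → ZMod M → ℝ) :
    dInner M h (v - w) z = dInner M h v z - dInner M h w z := by
  simp only [dInner, Pi.sub_apply, sub_mul, Finset.sum_sub_distrib, mul_sub]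

lemma dInner_smul_left (h c : ℝ) (v z : ZMod M → ZMod M → ℝ) :
    dInner M h (c • v) z = c * dInner M h v z := by
  simp only [dInner, Pi.smul_apply, smul_eq_mul, mul_assoc, ← Finset.mul_sum]
  ring

lemma dInner_sum_left (h : ℝ) (s : Finset ℕ) (v : ℕ → ZMod M → ZMod M → ℝ)
    (z : ZMod M → ZMod M → ℝ) :
    dInner M h (∑ k ∈ s, v k) z = ∑ k ∈ s, dInner M h (v k) z := by
  classical
  induction s using Finset.induction_on with
  | empty => simp [dInner]
  | insert a s ha ih => rw [Finset.sum_insert ha, Finset.sum_insert ha, dInner_add_left, ih]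

lemma dInner_self_nonneg (h : ℝ) (v : ZMod M → ZMod M → ℝ) : 0 ≤ dInner M h v v :=
  mul_nonneg (sq_nonneg _) (Finset.sum_nonneg fun i _ => Finset.sum_nonneg fun j _ =>
    mul_self_nonneg _)

lemma dNorm_sq (h : ℝ) (v : ZMod M → ZMod M → ℝ) : dNorm M h v * dNorm M h v = dInner M h v v :=
  Real.mul_self_sqrt (dInner_self_nonneg h v)

lemma dInner_le (h : ℝ) (v w : ZMod M → ZMod M → ℝ) :
    dInner M h v w ≤ dNorm M h v * dNorm M h w := by
  unfold dNorm
  rw [← Real.sqrt_mul (dInner_self_nonneg h v)]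
  apply Real.le_sqrt_of_sq_le
  unfold dInner
  simp only [← Fintype.sum_prod_type']
  have := Finset.sum_mul_sq_le_sq_mul_sq Finset.univ
    (fun p : ZMod M × ZMod M => v p.1 p.2) (fun p : ZMod M × ZMod M => w p.1 p.2)
  simp only [sq] at this ⊢
  have h2 := mul_le_mul_of_nonneg_left this (mul_self_nonneg (h * h))
  linarith

lemma opA_symm (h : ℝ) (v w : ZMod M → ZMod M → ℝ) :
    dInner M h (opA M h v) w = dInner M h v (opA M h w) := by
  have s1 : ∀ a b : ZMod M → ZMod M → ℝ,
      ∑ i, ∑ j, a (i + 1) j * b i j = ∑ i, ∑ j, a i j * b (i - 1) j := by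
    intro a b
    rw [← Equiv.sum_comp (Equiv.addRight (1 : ZMod M)) (fun i => ∑ j, a i j * b (i - 1) j)]
    simp
  have s2 : ∀ a b : ZMod M → ZMod M → ℝ,
      ∑ i, ∑ j, a i (j + 1) * b i j = ∑ i, ∑ j, a i j * b i (j - 1) := by
    intro a b
    apply Finset.sum_congr rfl
    intro i _
    rw [← Equiv.sum_comp (Equiv.addRight (1 : ZMod M)) (fun j => a i j * b i (j - 1))]
    simp
  have hc : ∀ a b : ZMod M → ZMod M → ℝ, ∑ i, ∑ j, a i j * b i j = ∑ i, ∑ j, b i j * a i j := by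
    intro a b; simp only [mul_comm]
  have e1 := s1 v w
  have e2 := s2 v w
  have e3 := s1 w v
  have e4 := s2 w v
  have f1 := hc (fun i j => v i j) (fun i j => w (i + 1) j)
  have f2 := hc (fun i j => v i j) (fun i j => w i (j + 1))
  have f3 := hc (fun i j => v (i - 1) j) (fun i j => w i j)
  have f4 := hc (fun i j => v i (j - 1)) (fun i j => w i j)
  unfold dInner
  congr 1
  have L : ∑ i, ∑ j, opA M h v i j * w i j = ∑ i, ∑ j, v i j * w i j + (1 / h ^ 2) *
      (∑ i, ∑ j, v (i + 1) j * w i j + ∑ i, ∑ j, v (i - 1) j * w i j +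
       ∑ i, ∑ j, v i (j + 1) * w i j + ∑ i, ∑ j, v i (j - 1) * w i j
        - 4 * ∑ i, ∑ j, v i j * w i j) := by
    simp only [Finset.mul_sum, ← Finset.sum_add_distrib, ← Finset.sum_sub_distrib]
    refine Finset.sum_congr rfl fun i _ => Finset.sum_congr rfl fun j _ => ?_
    simp only [opA, dLap, Pi.add_apply]
    ring
  have R : ∑ i, ∑ j, v i j * opA M h w i j = ∑ i, ∑ j, v i j * w i j + (1 / h ^ 2) *
      (∑ i, ∑ j, v i j * w (i + 1) j + ∑ i, ∑ j, v i j * w (i - 1) j +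
       ∑ i, ∑ j, v i j * w i (j + 1) + ∑ i, ∑ j, v i j * w i (j - 1)
        - 4 * ∑ i, ∑ j, v i j * w i j) := by
    simp only [Finset.mul_sum, ← Finset.sum_add_distrib, ← Finset.sum_sub_distrib]
    refine Finset.sum_congr rfl fun i _ => Finset.sum_congr rfl fun j _ => ?_
    simp only [opA, dLap, Pi.add_apply]
    ring
  rw [L, R, e1, e2, f3, f4, ← e3, ← e4, f1, f2]
  ring

lemma fPt_lower (h g ε c₀ c₁ : ℝ) (hg : 0 ≤ g) (hc₀ : 0 ≤ c₀) (hc₁ : 0 ≤ c₁)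
    (U u : ZMod M → ZMod M → ℝ)
    (hU : ∀ i j, |U i j| ≤ c₁) (hu : ∀ i j, |u i j| ≤ c₀) :
    -(c₁ ^ 2 + c₁ * c₀ + c₀ ^ 2 + g * (c₀ + c₁) + ε) * dInner M h (U - u) (U - u) ≤
      dInner M h (fPt g ε M U - fPt g ε M u) (U - u) := by
  unfold dInner
  rw [mul_left_comm]
  apply mul_le_mul_of_nonneg_left _ (sq_nonneg h)
  rw [Finset.mul_sum]
  apply Finset.sum_le_sum
  intro i _
  rw [Finset.mul_sum]
  apply Finset.sum_le_sum
  intro j _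
  simp only [Pi.sub_apply, fPt]
  set a := U i j
  set b := u i j
  have ha : a ≤ c₁ := (le_abs_self _).trans (hU i j)
  have hb : b ≤ c₀ := (le_abs_self _).trans (hu i j)
  have h1 : g * (a + b) ≤ g * (c₀ + c₁) := mul_le_mul_of_nonneg_left (by linarith) hg
  have h2 : 0 ≤ a ^ 2 + a * b + b ^ 2 := by nlinarith [sq_nonneg (a + b), sq_nonneg a, sq_nonneg b]
  have h3 : 0 ≤ c₁ * c₀ := mul_nonneg hc₁ hc₀
  have h4 : 0 ≤ (a ^ 2 + a * b + b ^ 2 - g * (a + b) - ε) +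
      (c₁ ^ 2 + c₁ * c₀ + c₀ ^ 2 + g * (c₀ + c₁) + ε) := by
    nlinarith [sq_nonneg c₁, sq_nonneg c₀]
  have h5 := mul_nonneg h4 (mul_self_nonneg (a - b))
  nlinarith

lemma L1_energy (h : ℝ) {α : ℝ} (hα : 0 < α ∧ α < 1) {t : ℕ → ℝ} {N : ℕ}
    (htmono : ∀ k, k < N → t k < t (k + 1)) (e : ℕ → ZMod M → ZMod M → ℝ)
    {n : ℕ} (hn1 : 1 ≤ n) (hn : n ≤ N) :
    (∑ k ∈ Finset.Icc 1 n, aK α t n k * (dNorm M h (e k) - dNorm M h (e (k - 1)))) *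
      dNorm M h (e n) ≤
    dInner M h (∑ k ∈ Finset.Icc 1 n, aK α t n k • (e k - e (k - 1))) (e n) := by
  have h1 := abel_nonneg (aK α t n) (fun k => dInner M h (e k) (e n) -
    dNorm M h (e k) * dNorm M h (e n)) n hn1 (aK_pos hα htmono le_rfl hn1 hn).le
    (fun k hk1 hk2 => aK_mono hα htmono hk1 hk2 hn)
    (fun k _ => sub_nonpos.2 (dInner_le h _ _))
  rw [dNorm_sq, sub_self, mul_zero] at h1
  rw [dInner_sum_left, Finset.sum_mul, ← sub_nonneg, ← Finset.sum_sub_distrib]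
  refine h1.trans (le_of_eq (Finset.sum_congr rfl fun k _ => ?_))
  rw [dInner_smul_left, dInner_sub_left]
  ring

end grid
/-- Theorem 4.1, L² norm error estimate -/
theorem L2_error_estimate
    (L : ℝ) (hL : 0 < L) (M : ℕ) [NeZero M] (hM : 2 ≤ M)
    (g ε : ℝ) (hg : 0 ≤ g) (hε : 0 < ε)
    (N : ℕ) (α T : ℝ) (hα : 0 < α ∧ α < 1)
    (t : ℕ → ℝ) (ht0 : t 0 = 0) (htN : t N = T)
    (htmono : ∀ k, k < N → t k < t (k + 1))
    (u U : ℕ → ZMod M → ZMod M → ℝ) (ξ η : ℕ → ZMod M → ZMod M → ℝ)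
    (c₀ c₁ ρ : ℝ)
    (hρ : ρ = c₁ ^ 2 + c₁ * c₀ + c₀ ^ 2 + g * (c₀ + c₁) + ε)
    (hscheme : ∀ n, 1 ≤ n → n ≤ N →
      (∑ k ∈ Finset.Icc 1 n, aK α t n k • (u k - u (k - 1)))
          + opA M (L / M) (opA M (L / M) (u n)) + fPt g ε M (u n) = 0)
    (he0 : U 0 - u 0 = 0)
    (herr : ∀ n, 1 ≤ n → n ≤ N →
      (∑ k ∈ Finset.Icc 1 n, aK α t n k • ((U k - u k) - (U (k - 1) - u (k - 1))))
          + opA M (L / M) (opA M (L / M) (U n - u n))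
          + (fPt g ε M (U n) - fPt g ε M (u n)) = ξ n + η n)
    (hUbound : ∀ n, n ≤ N → ∀ i j : ZMod M, |U n i j| ≤ c₁)
    (hubound : ∀ n, n ≤ N → ∀ i j : ZMod M, |u n i j| ≤ c₀)
    (hτ : ∀ k, 1 ≤ k → k ≤ N →
      (t k - t (k - 1)) ^ α ≤ 1 / (2 * Real.Gamma (2 - α) * ρ)) :
    ∀ n, ∀ hn1 : 1 ≤ n, n ≤ N →
      dNorm M (L / M) (U n - u n) ≤
        2 * mittagLeffler α (2 * ρ * (t n) ^ α / minStepRatio t N) *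
          ((Finset.Icc 1 n).sup' (Finset.nonempty_Icc.mpr hn1)
              (fun k => ∑ j ∈ Finset.Icc 1 k, pK α t k (k - j) * dNorm M (L / M) (ξ j))
            + omegaK (1 + α) (t n) *
                (Finset.Icc 1 n).sup' (Finset.nonempty_Icc.mpr hn1)
                  (fun j => dNorm M (L / M) (η j))) := by
  have hU0 := (abs_nonneg _).trans (hUbound 0 (by omega) 0 0)
  have hu0 := (abs_nonneg _).trans (hubound 0 (by omega) 0 0)
  have hρ0 : 0 < ρ := by
    rw [hρ]; positivity
  obtain ⟨hr, hr1, hrt⟩ := minStepRatio_spec htmono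
  have hnn : ∀ v : ZMod M → ZMod M → ℝ, 0 ≤ dNorm M (L / M) v := fun v => Real.sqrt_nonneg _
  refine gronwall_L1 hα ht0 htmono (minStepRatio t N) hr hr1 hrt ρ hρ0 hτ
    (fun n => dNorm M (L / M) (U n - u n)) (fun n => dNorm M (L / M) (ξ n))
    (fun n => dNorm M (L / M) (η n)) ?_ (fun n => hnn _) (fun n => hnn _) (fun n => hnn _) ?_
  · show dNorm M (L / M) (U 0 - u 0) = 0
    rw [he0]
    simp [dNorm, dInner]
  intro n hn1 hn
  rcases (hnn (U n - u n)).eq_or_lt with h0 | hpos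
  · have h1 := abel_nonneg (aK α t n) (fun k => - dNorm M (L / M) (U k - u k)) n hn1
      (aK_pos hα htmono le_rfl hn1 hn).le (fun k hk1 hk2 => aK_mono hα htmono hk1 hk2 hn)
      (fun k _ => neg_nonpos.2 (hnn _))
    rw [← h0, neg_zero, mul_zero] at h1
    have h2 : ∑ k ∈ Finset.Icc 1 n, aK α t n k *
        (- dNorm M (L / M) (U k - u k) - - dNorm M (L / M) (U (k - 1) - u (k - 1)))
        = - ∑ k ∈ Finset.Icc 1 n, aK α t n k *
        (dNorm M (L / M) (U k - u k) - dNorm M (L / M) (U (k - 1) - u (k - 1))) := by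
      rw [← Finset.sum_neg_distrib]
      refine Finset.sum_congr rfl fun k _ => ?_
      ring
    rw [h2] at h1
    rw [← h0]
    linarith [hnn (ξ n), hnn (η n)]
  · have hE := L1_energy (L / M) hα htmono (fun n => U n - u n) hn1 hn
    have heq := congrArg (fun v => dInner M (L / M) v (U n - u n)) (herr n hn1 hn)
    simp only [dInner_add_left] at heq
    rw [opA_symm] at heq
    have h1 := dInner_self_nonneg (L / M) (opA M (L / M) (U n - u n))
    have h2 := fPt_lower (L / M) g ε c₀ c₁ hg hu0 hU0 (U n) (u n) (hUbound n hn) (hubound n hn)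
    rw [← hρ, ← dNorm_sq] at h2
    have h3 := dInner_le (L / M) (ξ n) (U n - u n)
    have h4 := dInner_le (L / M) (η n) (U n - u n)
    refine le_of_mul_le_mul_right ?_ hpos
    linarith
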